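/- ∫_0^∞ x·e^{-πx/4} / ((1 + x²)·cosh(πx/4)) dx = π/2 - γ - log 2, where γ is the Euler–Mascheroni constant. -/

import Mathlib

open MeasureTheory Set Filter Topology

theorem integrableOn_exp_neg_mul_sin {a : ℝ} (ha : 0 < a) (s : ℝ) :
    IntegrableOn (fun x : ℝ => Real.exp (-a * x) * Real.sin (s * x)) (Ioi 0) := by
  refine (exp_neg_integrableOn_Ioi 0 ha).mono' (by fun_prop) (ae_of_all _ fun x => ?_)
  rw [norm_mul, Real.norm_eq_abs, Real.norm_eq_abs, Real.abs_exp]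
  exact mul_le_of_le_one_right (Real.exp_pos _).le (Real.abs_sin_le_one _)

theorem integral_exp_neg_mul_sin {a : ℝ} (ha : 0 < a) (s : ℝ) :
    ∫ x in Ioi (0 : ℝ), Real.exp (-a * x) * Real.sin (s * x) = s / (a ^ 2 + s ^ 2) := by
  have hre : (-a + s * Complex.I : ℂ).re < 0 := by simpa using ha
  have h := integral_exp_mul_complex_Ioi hre 0
  have him := integral_im (integrableOn_exp_mul_complex_Ioi hre 0)
  rw [h] at him
  have hpt : ∀ x : ℝ, RCLike.im (Complex.exp ((-a + s * Complex.I) * x)) =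
      Real.exp (-a * x) * Real.sin (s * x) := by
    intro x
    simp [Complex.exp_im]
  simp_rw [hpt] at him
  rw [him]
  simp [Complex.div_im, Complex.normSq_apply]
  ring

theorem integral_id_mul_exp_neg_mul {a : ℝ} (ha : 0 < a) :
    ∫ x in Ioi (0 : ℝ), x * Real.exp (-a * x) = 1 / a ^ 2 := by
  have h := Real.integral_rpow_mul_exp_neg_mul_Ioi (a := 2) two_pos ha
  norm_num at h
  simpa using h

theorem integrableOn_id_mul_exp_neg_mul {a : ℝ} (ha : 0 < a) :
    IntegrableOn (fun x : ℝ => x * Real.exp (-a * x)) (Ioi 0) := by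
  have h := integrableOn_rpow_mul_exp_neg_mul_rpow (p := 1) (s := 1) (by norm_num) one_pos ha
  simpa using h

theorem tsum_two_mul_div_sq_add_sq {r : ℝ} (hr : 0 < r) :
    ∑' n : ℕ, 2 * r / (r ^ 2 + (n + 1) ^ 2) =
      Real.pi * Real.cosh (Real.pi * r) / Real.sinh (Real.pi * r) - 1 / r := by
  have hmem : (r * Complex.I : ℂ) ∈ Complex.integerComplement := by
    rintro ⟨n, hn⟩
    have := congrArg Complex.im hn
    simp at this
    exact hr.ne this
  have h := cot_series_rep' hmem
  have hsinh : Complex.sinh (Real.pi * r) ≠ 0 := by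
    exact_mod_cast Real.sinh_ne_zero.mpr (by positivity)
  have hr' : (r : ℂ) ≠ 0 := by exact_mod_cast hr.ne'
  have hterm : ∀ n : ℕ, (1 / (r * Complex.I - (n + 1)) + 1 / (r * Complex.I + (n + 1)) : ℂ) =
      -Complex.I * ((2 * r / (r ^ 2 + (n + 1) ^ 2) : ℝ) : ℂ) := by
    intro n
    have h1 : (r * Complex.I - (n + 1) : ℂ) ≠ 0 := fun h0 =>
      hr.ne' (by simpa using congrArg Complex.im h0)
    have h2 : (r * Complex.I + (n + 1) : ℂ) ≠ 0 := fun h0 =>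
      hr.ne' (by simpa using congrArg Complex.im h0)
    have h3 : (r ^ 2 + (n + 1) ^ 2 : ℂ) ≠ 0 := by
      exact_mod_cast (by positivity : r ^ 2 + ((n : ℝ) + 1) ^ 2 ≠ 0)
    push_cast
    field_simp
    ring_nf
    simp only [show Complex.I ^ 3 = -Complex.I by simp [pow_succ]]
    ring
  simp_rw [hterm] at h
  rw [tsum_mul_left, ← Complex.ofReal_tsum, ← mul_assoc (Real.pi : ℂ), Complex.cot_eq_cos_div_sin,
    Complex.cos_mul_I, Complex.sin_mul_I] at h
  apply Complex.ofReal_injective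
  have hI := Complex.I_mul_I
  push_cast at h ⊢
  have := congrArg (Complex.I * ·) h
  simp only [← mul_assoc, mul_neg, hI, neg_neg, one_mul] at this
  rw [← this]
  field_simp

theorem integrableOn_sin_div_exp_sub_one {b : ℝ} (hb : 0 < b) (s : ℝ) :
    IntegrableOn (fun x : ℝ => Real.sin (s * x) / (Real.exp (b * x) - 1)) (Ioi 0) := by
  refine ((exp_neg_integrableOn_Ioi 0 (half_pos hb)).const_mul (|s| / b)).mono'
    (by fun_prop : Measurable _).aestronglyMeasurable ?_
  filter_upwards [ae_restrict_mem measurableSet_Ioi] with x hx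
  have hx : 0 < x := hx
  have hexp : b * x * Real.exp (b / 2 * x) ≤ Real.exp (b * x) - 1 := by
    have h1 := Real.self_le_sinh_iff.mpr (by positivity : 0 ≤ b / 2 * x)
    rw [Real.sinh_eq] at h1
    have h2 : Real.exp (b * x) = Real.exp (b / 2 * x) * Real.exp (b / 2 * x) := by
      rw [← Real.exp_add]; ring_nf
    have h3 : Real.exp (b / 2 * x) * Real.exp (-(b / 2 * x)) = 1 := by
      rw [← Real.exp_add]; simp
    nlinarith [Real.exp_pos (b / 2 * x)]
  have hpos : 0 < b * x * Real.exp (b / 2 * x) := by positivity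
  rw [norm_div, Real.norm_eq_abs, Real.norm_eq_abs, abs_of_pos (hpos.trans_le hexp), neg_mul,
    Real.exp_neg]
  calc |Real.sin (s * x)| / (Real.exp (b * x) - 1)
      ≤ |s * x| / (b * x * Real.exp (b / 2 * x)) := by
        gcongr ?_ / ?_
        exact Real.abs_sin_le_abs
    _ = |s| / b * (Real.exp (b / 2 * x))⁻¹ := by
        rw [abs_mul, abs_of_pos hx]; field_simp

theorem integral_sin_div_exp_sub_one {b s : ℝ} (hb : 0 < b) (hs : 0 < s) :
    ∫ x in Ioi (0 : ℝ), Real.sin (s * x) / (Real.exp (b * x) - 1) =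
      Real.pi / (2 * b) * (Real.cosh (Real.pi * (s / b)) / Real.sinh (Real.pi * (s / b))) -
        1 / (2 * s) := by
  have hpos : ∀ n : ℕ, 0 < ((n : ℝ) + 1) * b := fun n => by positivity
  have hsum := hasSum_integral_of_summable_integral_norm
    (fun n : ℕ => integrableOn_exp_neg_mul_sin (hpos n) s) ?_
  · have hser : ∫ x in Ioi (0 : ℝ), ∑' n : ℕ, Real.exp (-((n + 1) * b) * x) * Real.sin (s * x) =
        ∫ x in Ioi (0 : ℝ), Real.sin (s * x) / (Real.exp (b * x) - 1) := by
      refine setIntegral_congr_fun measurableSet_Ioi fun x hx => ?_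
      have hx : 0 < x := hx
      have hlt : Real.exp (-(b * x)) < 1 := Real.exp_lt_one_iff.mpr (by simp; positivity)
      have hgt : 1 < Real.exp (b * x) := Real.one_lt_exp_iff.mpr (by positivity)
      have hterm : ∀ n : ℕ, Real.exp (-((n + 1) * b) * x) =
          Real.exp (-(b * x)) * Real.exp (-(b * x)) ^ n := fun n => by
        rw [← pow_succ', ← Real.exp_nat_mul]; push_cast; ring_nf
      simp_rw [hterm]
      rw [tsum_mul_right, tsum_mul_left, tsum_geometric_of_lt_one (Real.exp_pos _).le hlt,
        Real.exp_neg]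
      have : Real.exp (b * x) - 1 ≠ 0 := (sub_pos.mpr hgt).ne'
      have h0 := Real.exp_pos (b * x)
      field_simp
    rw [← hser, ← hsum.tsum_eq]
    simp_rw [integral_exp_neg_mul_sin (hpos _)]
    have hcoth := tsum_two_mul_div_sq_add_sq (div_pos hs hb)
    calc ∑' n : ℕ, s / ((((n : ℝ) + 1) * b) ^ 2 + s ^ 2)
        = ∑' n : ℕ, 1 / (2 * b) * (2 * (s / b) / ((s / b) ^ 2 + ((n : ℝ) + 1) ^ 2)) := by
          congr with n
          field_simp
          ring
      _ = _ := by
          rw [tsum_mul_left, hcoth]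
          field_simp
  · refine Summable.of_nonneg_of_le (fun n => integral_nonneg fun x => norm_nonneg _)
      (fun n => ?_) (((summable_nat_add_iff 1).mpr
        (Real.summable_one_div_nat_pow.mpr one_lt_two)).mul_left (s / b ^ 2))
    calc ∫ x in Ioi (0 : ℝ), ‖Real.exp (-((n + 1) * b) * x) * Real.sin (s * x)‖
        ≤ ∫ x in Ioi (0 : ℝ), s * (x * Real.exp (-((n + 1) * b) * x)) := by
          refine setIntegral_mono_on (integrableOn_exp_neg_mul_sin (hpos n) s).norm
            ((integrableOn_id_mul_exp_neg_mul (hpos n)).const_mul s) measurableSet_Ioi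
            fun x hx => ?_
          have hx : 0 < x := hx
          have h1 : |Real.sin (s * x)| ≤ s * x :=
            Real.abs_sin_le_abs.trans_eq (abs_of_pos (by positivity))
          rw [norm_mul, Real.norm_eq_abs, Real.norm_eq_abs, Real.abs_exp]
          nlinarith [Real.exp_pos (-((n + 1) * b) * x)]
      _ = s / b ^ 2 * (1 / ((n + 1 : ℕ) : ℝ) ^ 2) := by
          rw [integral_const_mul, integral_id_mul_exp_neg_mul (hpos n)]
          push_cast
          field_simp

theorem integral_sin_div_exp_add_one {b s : ℝ} (hb : 0 < b) (hs : 0 < s) :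
    ∫ x in Ioi (0 : ℝ), Real.sin (s * x) / (Real.exp (b * x) + 1) =
      1 / (2 * s) - Real.pi / (2 * b * Real.sinh (Real.pi * (s / b))) := by
  have hsplit : ∫ x in Ioi (0 : ℝ), Real.sin (s * x) / (Real.exp (b * x) + 1) =
      ∫ x in Ioi (0 : ℝ), (Real.sin (s * x) / (Real.exp (b * x) - 1) -
        2 * (Real.sin (s * x) / (Real.exp (2 * b * x) - 1))) := by
    refine setIntegral_congr_fun measurableSet_Ioi fun x hx => ?_
    have hx : 0 < x := hx
    have h1 : 0 < Real.exp (b * x) - 1 := sub_pos.mpr (Real.one_lt_exp_iff.mpr (by positivity))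
    have h2 : Real.exp (2 * b * x) - 1 = (Real.exp (b * x) - 1) * (Real.exp (b * x) + 1) := by
      rw [mul_assoc, two_mul, Real.exp_add]; ring
    have h3 : 0 < Real.exp (b * x) + 1 := by positivity
    simp only [h2]
    generalize Real.exp (b * x) = E at h1 h3 ⊢
    have h4 : E - 1 ≠ 0 := h1.ne'
    field_simp
    ring
  have hu : 0 < Real.pi * (s / (2 * b)) := by positivity
  have hdouble : Real.pi * (s / b) = 2 * (Real.pi * (s / (2 * b))) := by field_simp
  have hS := Real.sinh_pos_iff.mpr hu
  have hC := Real.cosh_pos (Real.pi * (s / (2 * b)))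
  rw [hsplit, integral_sub (integrableOn_sin_div_exp_sub_one hb s)
    ((integrableOn_sin_div_exp_sub_one (by positivity : 0 < 2 * b) s).const_mul 2),
    integral_const_mul, integral_sin_div_exp_sub_one hb hs,
    integral_sin_div_exp_sub_one (by positivity : 0 < 2 * b) hs, hdouble, Real.cosh_two_mul,
    Real.sinh_two_mul, Real.sinh_sq]
  set C := Real.cosh (Real.pi * (s / (2 * b)))
  set S := Real.sinh (Real.pi * (s / (2 * b)))
  field_simp
  ring

theorem integral_exp_neg_sub_exp_neg_mul_div {c : ℝ} (hc : 1 ≤ c) :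
    IntegrableOn (fun x : ℝ => (Real.exp (-x) - Real.exp (-c * x)) / x) (Ioi 0) ∧
      ∫ x in Ioi (0 : ℝ), (Real.exp (-x) - Real.exp (-c * x)) / x = Real.log c := by
  have hint : IntegrableOn (fun x : ℝ => (Real.exp (-x) - Real.exp (-c * x)) / x) (Ioi 0) := by
    refine ((exp_neg_integrableOn_Ioi 0 one_pos).const_mul (c - 1)).mono'
      (by fun_prop : Measurable _).aestronglyMeasurable ?_
    filter_upwards [ae_restrict_mem measurableSet_Ioi] with x hx
    have hx : 0 < x := hx
    have h1 : Real.exp (-c * x) = Real.exp (-x) * Real.exp (-((c - 1) * x)) := by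
      rw [← Real.exp_add]; ring_nf
    have h2 := Real.add_one_le_exp (-((c - 1) * x))
    have h3 : Real.exp (-((c - 1) * x)) ≤ 1 :=
      Real.exp_le_one_iff.mpr (by nlinarith)
    have h4 := Real.exp_pos (-x)
    rw [h1, Real.norm_eq_abs, abs_of_nonneg (div_nonneg (by nlinarith) hx.le), div_le_iff₀ hx,
      neg_one_mul]
    nlinarith
  refine ⟨hint, ?_⟩
  have hcont : Continuous fun x : ℝ => Real.exp (-x) := by fun_prop
  have h := Frullani.integral_Ioi_eq (f := fun x : ℝ => Real.exp (-x)) (a := 1) (b := c)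
    (L := 1) (R := 0) (hcont.locallyIntegrable.locallyIntegrableOn _) one_pos (by linarith)
    ((by simpa using hcont.tendsto 0 :
      Tendsto (fun x : ℝ => Real.exp (-x)) (𝓝 0) (𝓝 1)).mono_left nhdsWithin_le_nhds)
    Real.tendsto_exp_neg_atTop_nhds_zero
    (by simpa [div_eq_inv_mul] using hint)
  simpa [div_eq_inv_mul] using h

theorem inv_one_sub_exp_neg_sub_inv_mem_Icc {x : ℝ} (hx : 0 < x) :
    1 / (1 - Real.exp (-x)) - 1 / x ∈ Icc (0 : ℝ) 1 := by
  have h1 := Real.add_one_le_exp (-x)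
  have h2 := Real.add_one_le_exp x
  have h3 : Real.exp x * Real.exp (-x) = 1 := by rw [← Real.exp_add]; simp
  have h4 : Real.exp (-x) < 1 := Real.exp_lt_one_iff.mpr (by linarith)
  have h5 : 0 < 1 - Real.exp (-x) := by linarith
  constructor
  · rw [sub_nonneg]
    exact one_div_le_one_div_of_le h5 (by linarith)
  · rw [div_sub_div _ _ h5.ne' hx.ne', div_le_one (by positivity)]
    nlinarith [Real.exp_pos (-x)]

theorem integrableOn_exp_neg_mul_inv_one_sub_exp_neg_sub_inv :
    IntegrableOn (fun x : ℝ => Real.exp (-x) * (1 / (1 - Real.exp (-x)) - 1 / x)) (Ioi 0) := by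
  refine (exp_neg_integrableOn_Ioi 0 one_pos).mono'
    (by fun_prop : Measurable _).aestronglyMeasurable ?_
  filter_upwards [ae_restrict_mem measurableSet_Ioi] with x hx
  obtain ⟨h0, h1⟩ := inv_one_sub_exp_neg_sub_inv_mem_Icc hx
  rw [norm_mul, Real.norm_eq_abs, Real.norm_eq_abs, Real.abs_exp, abs_of_nonneg h0, neg_one_mul]
  exact mul_le_of_le_one_right (Real.exp_pos _).le h1

theorem integral_exp_neg_mul_inv_one_sub_exp_neg_sub_inv :
    ∫ x in Ioi (0 : ℝ), Real.exp (-x) * (1 / (1 - Real.exp (-x)) - 1 / x) =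
      Real.eulerMascheroniConstant := by
  let g : ℝ → ℝ := fun x => Real.exp (-x) * (1 / (1 - Real.exp (-x)) - 1 / x)
  have hlim : Tendsto (fun N : ℕ => ∫ x in Ioi (0 : ℝ), (1 - Real.exp (-x) ^ N) * g x) atTop
      (𝓝 (∫ x in Ioi (0 : ℝ), g x)) := by
    refine tendsto_integral_of_dominated_convergence (fun x => ‖g x‖)
      (fun N => (by fun_prop : Measurable _).aestronglyMeasurable)
      integrableOn_exp_neg_mul_inv_one_sub_exp_neg_sub_inv.norm (fun N => ?_) ?_
    · filter_upwards [ae_restrict_mem measurableSet_Ioi] with x hx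
      have hx : 0 < x := hx
      have h1 : Real.exp (-x) ^ N ≤ 1 :=
        pow_le_one₀ (Real.exp_pos _).le (Real.exp_le_one_iff.mpr (by linarith))
      have h2 : 0 < Real.exp (-x) ^ N := by positivity
      rw [norm_mul]
      refine mul_le_of_le_one_left (norm_nonneg _) ?_
      rw [Real.norm_eq_abs, abs_le]
      constructor <;> linarith
    · filter_upwards [ae_restrict_mem measurableSet_Ioi] with x hx
      have hx : 0 < x := hx
      have := tendsto_pow_atTop_nhds_zero_of_lt_one (Real.exp_pos (-x)).le
        (Real.exp_lt_one_iff.mpr (by linarith))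
      simpa using (this.const_sub 1).mul_const (g x)
  refine tendsto_nhds_unique hlim (Real.tendsto_eulerMascheroniSeq.congr fun N => ?_)
  obtain ⟨hint, hval⟩ := integral_exp_neg_sub_exp_neg_mul_div (c := N + 1) (by simp)
  have hpos : ∀ n : ℕ, 0 < (n : ℝ) + 1 := fun n => by positivity
  have hexp : ∀ n : ℕ, IntegrableOn (fun x : ℝ => Real.exp (-((n : ℝ) + 1) * x)) (Ioi 0) :=
    fun n => exp_neg_integrableOn_Ioi 0 (hpos n)
  have hharm : ∫ x in Ioi (0 : ℝ), ∑ n ∈ Finset.range N, Real.exp (-((n : ℝ) + 1) * x) =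
      harmonic N := by
    rw [integral_finsetSum _ fun n _ => hexp n, harmonic]
    push_cast
    refine Finset.sum_congr rfl fun n _ => ?_
    rw [integral_exp_mul_Ioi (neg_lt_zero.mpr (hpos n)), mul_zero, Real.exp_zero, neg_div_neg_eq,
      one_div]
  rw [Real.eulerMascheroniSeq, ← hharm, ← hval,
    ← integral_sub (integrable_finsetSum _ fun n _ => hexp n) hint]
  refine setIntegral_congr_fun measurableSet_Ioi fun x hx => ?_
  have hx : 0 < x := hx
  have hpow : ∀ n : ℕ, Real.exp (-((n : ℝ) + 1) * x) = Real.exp (-x) * Real.exp (-x) ^ n :=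
    fun n => by rw [← pow_succ', ← Real.exp_nat_mul]; push_cast; ring_nf
  have hne : 1 - Real.exp (-x) ≠ 0 := (sub_pos.mpr (Real.exp_lt_one_iff.mpr (by linarith))).ne'
  have hgeom := mul_neg_geom_sum (Real.exp (-x)) N
  simp only [hpow, ← Finset.mul_sum, g]
  rw [eq_div_of_mul_eq hne ((mul_comm _ _).trans hgeom)]
  field_simp

theorem hasDerivAt_log_one_add_exp_neg_sub_two_mul_arctan_exp_neg (x : ℝ) :
    HasDerivAt (fun x : ℝ => Real.log (1 + Real.exp (-x)) - 2 * Real.arctan (Real.exp (-x)))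
      (Real.exp (-x) * (2 / (1 + Real.exp (-x) ^ 2) - 1 / (1 + Real.exp (-x)))) x := by
  have he : HasDerivAt (fun x : ℝ => Real.exp (-x)) (-Real.exp (-x)) x := by
    simpa using (hasDerivAt_neg x).exp
  refine (((he.const_add 1).log (by positivity)).sub (he.arctan.const_mul 2)).congr_deriv ?_
  ring

theorem integrableOn_exp_neg_mul_two_div_sub_one_div :
    IntegrableOn (fun x : ℝ =>
      Real.exp (-x) * (2 / (1 + Real.exp (-x) ^ 2) - 1 / (1 + Real.exp (-x)))) (Ioi 0) := by
  refine ((exp_neg_integrableOn_Ioi 0 one_pos).const_mul 2).mono'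
    (by fun_prop : Measurable _).aestronglyMeasurable (ae_of_all _ fun x => ?_)
  have he : 0 < Real.exp (-x) := Real.exp_pos _
  have h1 : 2 / (1 + Real.exp (-x) ^ 2) ≤ 2 := div_le_self two_pos.le (by nlinarith)
  have h2 : 1 / (1 + Real.exp (-x)) ≤ 1 := div_le_self one_pos.le (by linarith)
  have h3 : 0 < 2 / (1 + Real.exp (-x) ^ 2) := by positivity
  have h4 : 0 < 1 / (1 + Real.exp (-x)) := by positivity
  rw [norm_mul, Real.norm_eq_abs, Real.norm_eq_abs, Real.abs_exp, neg_one_mul, mul_comm 2]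
  gcongr
  rw [abs_le]
  constructor <;> linarith

theorem integral_exp_neg_mul_two_div_sub_one_div :
    ∫ x in Ioi (0 : ℝ),
        Real.exp (-x) * (2 / (1 + Real.exp (-x) ^ 2) - 1 / (1 + Real.exp (-x))) =
      Real.pi / 2 - Real.log 2 := by
  have hcont : ContinuousAt
      (fun u : ℝ => Real.log (1 + u) - 2 * Real.arctan u) 0 := by
    refine ContinuousAt.sub (ContinuousAt.log (by fun_prop) (by simp)) (by fun_prop)
  have htend := hcont.tendsto.comp Real.tendsto_exp_neg_atTop_nhds_zero
  rw [integral_Ioi_of_hasDerivAt_of_tendsto'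
    (fun x _ => hasDerivAt_log_one_add_exp_neg_sub_two_mul_arctan_exp_neg x)
    integrableOn_exp_neg_mul_two_div_sub_one_div htend]
  norm_num [Real.arctan_one]
  ring

theorem integral_exp_neg_mul_inv_sub_two_div_sinh :
    ∫ s in Ioi (0 : ℝ), Real.exp (-s) * (1 / s - 2 / Real.sinh (2 * s)) =
      Real.pi / 2 - Real.eulerMascheroniConstant - Real.log 2 := by
  rw [sub_right_comm, ← integral_exp_neg_mul_two_div_sub_one_div,
    ← integral_exp_neg_mul_inv_one_sub_exp_neg_sub_inv,
    ← integral_sub integrableOn_exp_neg_mul_two_div_sub_one_div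
      integrableOn_exp_neg_mul_inv_one_sub_exp_neg_sub_inv]
  refine setIntegral_congr_fun measurableSet_Ioi fun s hs => ?_
  have hs : 0 < s := hs
  have hu : 0 < Real.exp (-s) := Real.exp_pos _
  have hlt : Real.exp (-s) < 1 := Real.exp_lt_one_iff.mpr (by linarith)
  have hsinh : Real.sinh (2 * s) = (1 - Real.exp (-s) ^ 4) / (2 * Real.exp (-s) ^ 2) := by
    have h1 : Real.exp (-(2 * s)) = Real.exp (-s) ^ 2 := by
      rw [← Real.exp_nat_mul]; push_cast; ring_nf
    rw [Real.sinh_eq, ← neg_neg (2 * s), Real.exp_neg (-(2 * s)), neg_neg, h1]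
    field_simp
  have hne : 1 - Real.exp (-s) ≠ 0 := by linarith
  have hfac : 1 - Real.exp (-s) ^ 4 =
      (1 - Real.exp (-s)) * (1 + Real.exp (-s)) * (1 + Real.exp (-s) ^ 2) := by ring
  simp only [hsinh, hfac]
  field_simp
  ring

theorem integral_mul_exp_neg_div_one_add_sq_mul_cosh_eq_sine_transform :
    ∫ x in Ioi (0 : ℝ), x / (1 + x ^ 2) * (2 / (Real.exp (Real.pi / 2 * x) + 1)) =
      ∫ s in Ioi (0 : ℝ), Real.exp (-s) * (1 / s - 2 / Real.sinh (2 * s)) := by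
  have hb : 0 < Real.pi / 2 := by positivity
  let F : ℝ → ℝ → ℝ := fun x s =>
    (Real.exp (-1 * s) * Real.sin (x * s)) * (2 / (Real.exp (Real.pi / 2 * x) + 1))
  have hF : Integrable (Function.uncurry F)
      ((volume.restrict (Ioi 0)).prod (volume.restrict (Ioi 0))) := by
    refine (((exp_neg_integrableOn_Ioi 0 hb).const_mul 2).mul_prod
      (exp_neg_integrableOn_Ioi 0 one_pos)).mono'
      (by simp only [F, Function.uncurry_def]; fun_prop : Measurable _).aestronglyMeasurable
      (ae_of_all _ fun ⟨x, s⟩ => ?_)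
    have h1 : 2 / (Real.exp (Real.pi / 2 * x) + 1) ≤ 2 * Real.exp (-(Real.pi / 2) * x) := by
      rw [neg_mul, Real.exp_neg, ← div_eq_mul_inv]
      gcongr
      linarith
    have h2 : 0 < 2 / (Real.exp (Real.pi / 2 * x) + 1) := by positivity
    simp only [F, Function.uncurry_apply_pair, norm_mul, Real.norm_eq_abs, Real.abs_exp,
      abs_of_pos h2]
    rw [mul_comm]
    gcongr
    exact mul_le_of_le_one_right (Real.exp_pos _).le (Real.abs_sin_le_one _)
  have hswap := integral_integral_swap hF
  have hL : ∀ x : ℝ, ∫ s in Ioi (0 : ℝ), F x s =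
      x / (1 + x ^ 2) * (2 / (Real.exp (Real.pi / 2 * x) + 1)) := fun x => by
    rw [integral_mul_const, integral_exp_neg_mul_sin one_pos, one_pow]
  simp_rw [hL] at hswap
  rw [hswap]
  refine setIntegral_congr_fun measurableSet_Ioi fun s hs => ?_
  have hs : 0 < s := hs
  have hR : ∀ x : ℝ, F x s = 2 * Real.exp (-s) *
      (Real.sin (s * x) / (Real.exp (Real.pi / 2 * x) + 1)) := fun x => by
    simp only [F, neg_one_mul, mul_comm x s]
    ring
  simp_rw [hR]
  rw [integral_const_mul, integral_sin_div_exp_add_one hb hs,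
    show Real.pi * (s / (Real.pi / 2)) = 2 * s by field_simp]
  have := Real.sinh_pos_iff.mpr (by positivity : 0 < 2 * s)
  field_simp


/-- `∫_0^∞ x e^{-πx/4}/((1+x²) cosh(πx/4)) dx = π/2 - γ - log 2`, where `γ` is the
Euler–Mascheroni constant. -/
theorem integral_tanh_khintchine_total_mass :
    ∫ x in Set.Ioi (0 : ℝ),
        x * Real.exp (-Real.pi * x / 4) / ((1 + x ^ 2) * Real.cosh (Real.pi * x / 4)) =
      Real.pi / 2 - Real.eulerMascheroniConstant - Real.log 2 := by
  rw [← integral_exp_neg_mul_inv_sub_two_div_sinh,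
    ← integral_mul_exp_neg_div_one_add_sq_mul_cosh_eq_sine_transform]
  refine setIntegral_congr_fun measurableSet_Ioi fun x _ => ?_
  have h1 : Real.exp (-Real.pi * x / 4) = (Real.exp (Real.pi * x / 4))⁻¹ := by
    rw [← Real.exp_neg]; ring_nf
  have h2 : Real.exp (Real.pi / 2 * x) = Real.exp (Real.pi * x / 4) ^ 2 := by
    rw [← Real.exp_nat_mul]; push_cast; ring_nf
  have h3 := Real.exp_pos (Real.pi * x / 4)
  simp only [Real.cosh_eq, Real.exp_neg, h1, h2]
  field_simp
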